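/- There exists a real constant C > 0 such that for every ε > 0 there is a constant C(ε) > 0 with the following property: for all real x ≥ 3 and all real y with x^ε ≤ y ≤ x^{1/2}, one has |Q₁(x,y) − C·x| ≤ C(ε)·(x^{1+ε}·y^{−1/2} + x^{1/2+ε}·y^{1/2}), where Q₁(x,y) := Σ_{s ≤ y squarefull} Σ_{d ≥ 1, d²s ≤ y, gcd(d,s)=1} μ(d) Σ_{n ≤ x/(d²s), gcd(n,s)=1} a(d²·n·s + a(s)), the outer sum running over squarefull positive integers s ≤ y. -/

import Mathlib

/-- `abelianCount n` is the number of isomorphism classes of abelian groups of order `n`: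
the multiplicative function with `abelianCount (p^α) = P(α)`, the number of partitions of `α`. -/
def abelianCount (n : ℕ) : ℕ :=
  n.factorization.prod fun _ α => Fintype.card (Nat.Partition α)

/-- A positive integer is squarefull (powerful) if `p ∣ s` implies `p ^ 2 ∣ s` for every prime. -/
def Squarefull (s : ℕ) : Prop := ∀ p : ℕ, p.Prime → p ∣ s → p ^ 2 ∣ s

lemma inv_one_sub_le_exp {w z : ℝ} (hw : 0 ≤ w) (hwz : w ≤ z) (hz : z < 1) :
    (1 - w)⁻¹ ≤ Real.exp (w / (1 - z)) := by
  have h1 : 0 < 1 - w := by linarith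
  have h2 : 0 < 1 - z := by linarith
  calc (1 - w)⁻¹ = w / (1 - w) + 1 := by field_simp; ring
    _ ≤ w / (1 - z) + 1 := by gcongr
    _ ≤ _ := Real.add_one_le_exp _

lemma card_partition_mul_pow_le {z : ℝ} (hz : 0 < z) (hz1 : z < 1) (n : ℕ) :
    (Fintype.card (Nat.Partition n) : ℝ) * z ^ n ≤ Real.exp (((1 - z) ^ 2)⁻¹) := by
  classical
  have h2 : 0 < 1 - z := by linarith
  let φ : Nat.Partition n → (Fin n → Fin (n + 1)) := fun p i =>
    Fin.ofNat (n + 1) (p.parts.count (i.val + 1))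
  have hcount : ∀ (p : Nat.Partition n) (i : Fin n),
      ((φ p i : Fin (n + 1)) : ℕ) = p.parts.count (i.val + 1) := by
    intro p i
    have h : p.parts.count (i.val + 1) ≤ n := by
      by_contra! h
      have h3 : Multiset.replicate (p.parts.count (i.val + 1)) (i.val + 1) ≤ p.parts :=
        Multiset.le_count_iff_replicate_le.mp le_rfl
      obtain ⟨u, hu⟩ := Multiset.le_iff_exists_add.mp h3
      have h5 : p.parts.sum = n := p.parts_sum
      rw [hu] at h5
      simp only [Multiset.sum_add, Multiset.sum_replicate, smul_eq_mul] at h5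
      have h6 := Nat.le_mul_of_pos_right (p.parts.count (i.val + 1)) (Nat.succ_pos i.val)
      simp only [Nat.succ_eq_add_one] at h6
      omega
    simp only [φ, Fin.ofNat]
    exact Nat.mod_eq_of_lt (by omega)
  have hinj : Function.Injective φ := by
    intro p q h
    ext1
    ext a
    by_cases ha : 1 ≤ a ∧ a ≤ n
    · have := congrArg (fun f => ((f ⟨a - 1, by omega⟩ : Fin (n + 1)) : ℕ)) h
      simp only [hcount] at this
      rwa [show a - 1 + 1 = a by omega] at this
    · have : ∀ p : Nat.Partition n, p.parts.count a = 0 := by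
        intro p
        rw [Multiset.count_eq_zero]
        intro hm
        exact ha ⟨p.parts_pos hm, p.le_of_mem_parts hm⟩
      rw [this, this]
  have hsum : ∀ p : Nat.Partition n, ∑ i : Fin n, (i.val + 1) * (φ p i : ℕ) = n := by
    intro p
    have h1 : p.parts.sum = ∑ i ∈ Finset.Ico 1 (n + 1), p.parts.count i • i :=
      Finset.sum_multiset_count_of_subset _ _ (fun a ha => by
        rw [Multiset.mem_toFinset] at ha
        have := p.parts_pos ha
        have := p.le_of_mem_parts ha
        simp only [Finset.mem_Ico]
        omega)
    rw [p.parts_sum, Finset.sum_Ico_eq_sum_range] at h1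
    simp only [hcount]
    rw [Fin.sum_univ_eq_sum_range (fun i => (i + 1) * p.parts.count (i + 1)) n]
    conv_rhs => rw [h1]
    refine Finset.sum_congr (by simp) fun i _ => ?_
    rw [add_comm 1 i, smul_eq_mul, mul_comm]
  calc (Fintype.card (Nat.Partition n) : ℝ) * z ^ n
      = ∑ p : Nat.Partition n, ∏ i : Fin n, (z ^ (i.val + 1)) ^ (φ p i : ℕ) := by
        rw [Finset.sum_congr rfl (fun p _ => ?_), Finset.sum_const, Finset.card_univ, nsmul_eq_mul]
        simp_rw [← pow_mul]
        rw [Finset.prod_pow_eq_pow_sum, hsum]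
    _ = ∑ f ∈ Finset.univ.image φ, ∏ i : Fin n, (z ^ (i.val + 1)) ^ (f i : ℕ) := by
        rw [Finset.sum_image (fun _ _ _ _ h => hinj h)]
    _ ≤ ∑ f : Fin n → Fin (n + 1), ∏ i : Fin n, (z ^ (i.val + 1)) ^ (f i : ℕ) :=
        Finset.sum_le_sum_of_subset_of_nonneg (Finset.subset_univ _)
          (fun _ _ _ => Finset.prod_nonneg fun _ _ => by positivity)
    _ = ∏ i : Fin n, ∑ j : Fin (n + 1), (z ^ (i.val + 1)) ^ (j : ℕ) := by
        rw [Finset.prod_univ_sum, Fintype.piFinset_univ]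
    _ ≤ ∏ i : Fin n, Real.exp (z ^ (i.val + 1) / (1 - z)) := by
        refine Finset.prod_le_prod (fun _ _ => Finset.sum_nonneg fun _ _ => by positivity) ?_
        intro i _
        have hw1 : z ^ (i.val + 1) ≤ z := pow_le_of_le_one hz.le hz1.le (by omega)
        refine le_trans ?_ (inv_one_sub_le_exp (by positivity) hw1 hz1)
        rw [Fin.sum_univ_eq_sum_range (fun j => (z ^ (i.val + 1)) ^ j),
          ← tsum_geometric_of_lt_one (by positivity) (hw1.trans_lt hz1)]
        exact (summable_geometric_of_lt_one (by positivity) (hw1.trans_lt hz1)).sum_le_tsum _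
          (fun _ _ => by positivity)
    _ = Real.exp (∑ i : Fin n, z ^ (i.val + 1) / (1 - z)) := (Real.exp_sum _ _).symm
    _ ≤ _ := by
        rw [Real.exp_le_exp, Fin.sum_univ_eq_sum_range (fun j => z ^ (j + 1) / (1 - z)),
          ← Finset.sum_div]
        have h3 : ∑ i ∈ Finset.range n, z ^ (i + 1) ≤ (1 - z)⁻¹ := by
          rw [← tsum_geometric_of_lt_one hz.le hz1]
          refine le_trans (Finset.sum_le_sum fun i _ => ?_)
            ((summable_geometric_of_lt_one hz.le hz1).sum_le_tsum (Finset.range n)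
              (fun _ _ => by positivity))
          exact pow_le_pow_of_le_one hz.le hz1.le (by omega)
        rw [sq, mul_inv, div_eq_mul_inv]
        gcongr

/-- A product over the factorization of `n` of subexponential local factors is `O(n ^ ε)`. -/
lemma exists_factorization_prod_le {g : ℕ → ℝ} (hg : ∀ α, 0 ≤ g α)
    (hsub : ∀ δ : ℝ, 0 < δ → ∃ C : ℝ, ∀ α, g α ≤ C * (1 + δ) ^ α) {ε : ℝ} (hε : 0 < ε) :
    ∃ K : ℝ, 0 < K ∧ ∀ n : ℕ, n ≠ 0 → n.factorization.prod (fun _ α => g α) ≤ K * (n : ℝ) ^ ε := by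
  obtain ⟨C₁, hC₁⟩ := hsub 1 one_pos
  have h2ε : (1 : ℝ) < 2 ^ ε := Real.one_lt_rpow (by norm_num) hε
  obtain ⟨C₂, hC₂⟩ := hsub (2 ^ ε - 1) (by linarith)
  set A : ℝ := 2 * max C₁ 1 with hA
  set B : ℝ := max C₂ 1 with hB
  have hm1 : (1 : ℝ) ≤ max C₁ 1 := le_max_right _ _
  have hB1 : (1 : ℝ) ≤ B := le_max_right _ _
  have hA1 : 1 ≤ A := by rw [hA]; linarith
  obtain ⟨M, hM⟩ := exists_nat_ge (A ^ (1 / ε))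
  have hgA : ∀ α, α ≠ 0 → g α ≤ A ^ α := by
    intro α hα
    refine (hC₁ α).trans ?_
    rw [hA, mul_pow, mul_comm, show (1 : ℝ) + 1 = 2 by norm_num]
    gcongr
    exact (le_max_left _ _).trans (le_self_pow₀ hm1 hα)
  have hgB : ∀ α, g α ≤ B * (2 ^ ε) ^ α := by
    intro α
    refine (hC₂ α).trans ?_
    rw [show 1 + ((2 : ℝ) ^ ε - 1) = 2 ^ ε by ring]
    gcongr
    exact le_max_left _ _
  refine ⟨B ^ M, by positivity, fun n hn => ?_⟩
  have hfac : ∀ p ∈ n.primeFactors,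
      g (n.factorization p) ≤ (if p < M then B else 1) * ((p : ℝ) ^ n.factorization p) ^ ε := by
    intro p hp
    have hpp := Nat.prime_of_mem_primeFactors hp
    have hα : n.factorization p ≠ 0 := by
      rw [← Finsupp.mem_support_iff]; exact hp
    have hcomm : ((p : ℝ) ^ n.factorization p) ^ ε = ((p : ℝ) ^ ε) ^ n.factorization p := by
      rw [← Real.rpow_natCast, ← Real.rpow_mul (by positivity), mul_comm,
        Real.rpow_mul (by positivity), Real.rpow_natCast]
    rw [hcomm]
    split_ifs with h
    · refine (hgB _).trans ?_
      gcongr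
      exact_mod_cast hpp.two_le
    · rw [one_mul]
      refine (hgA _ hα).trans ?_
      gcongr
      push Not at h
      calc A = (A ^ (1 / ε)) ^ ε := by
            rw [← Real.rpow_mul (by linarith), one_div_mul_cancel hε.ne', Real.rpow_one]
        _ ≤ (p : ℝ) ^ ε := by
            gcongr
            exact hM.trans (by exact_mod_cast h)
  calc n.factorization.prod (fun _ α => g α)
      ≤ ∏ p ∈ n.primeFactors,
          (if p < M then B else 1) * ((p : ℝ) ^ n.factorization p) ^ ε :=
        Finset.prod_le_prod (fun _ _ => hg _) hfac
    _ = (∏ p ∈ n.primeFactors, if p < M then B else 1) * (n : ℝ) ^ ε := by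
        rw [Finset.prod_mul_distrib]
        congr 1
        rw [Real.finsetProd_rpow _ _ (fun _ _ => by positivity)]
        congr 1
        conv_rhs => rw [← Nat.prod_factorization_pow_eq_self hn]
        rw [Finsupp.prod, Nat.cast_prod]
        simp
    _ ≤ B ^ M * (n : ℝ) ^ ε := by
        gcongr
        rw [← Finset.prod_filter, Finset.prod_const]
        refine pow_le_pow_right₀ hB1 ?_
        calc _ ≤ (Finset.range M).card := Finset.card_le_card (by intro p; simp)
          _ = M := Finset.card_range M

lemma exists_abelianCount_le {ε : ℝ} (hε : 0 < ε) :
    ∃ K : ℝ, 0 < K ∧ ∀ n : ℕ, n ≠ 0 → (abelianCount n : ℝ) ≤ K * (n : ℝ) ^ ε := by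
  obtain ⟨K, hK, h⟩ := exists_factorization_prod_le
    (g := fun α => (Fintype.card (Nat.Partition α) : ℝ)) (fun _ => by positivity) (fun δ hδ => by
      refine ⟨Real.exp (((1 - (1 + δ)⁻¹) ^ 2)⁻¹), fun α => ?_⟩
      have := card_partition_mul_pow_le (z := (1 + δ)⁻¹) (by positivity)
        (inv_lt_one_of_one_lt₀ (by linarith)) α
      rwa [inv_pow, ← div_eq_mul_inv, div_le_iff₀ (by positivity)] at this) hε
  refine ⟨K, hK, fun n hn => ?_⟩
  simpa [abelianCount, Finsupp.prod] using h n hn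

lemma exists_card_divisors_le {ε : ℝ} (hε : 0 < ε) :
    ∃ K : ℝ, 0 < K ∧ ∀ n : ℕ, n ≠ 0 → (n.divisors.card : ℝ) ≤ K * (n : ℝ) ^ ε := by
  obtain ⟨K, hK, h⟩ := exists_factorization_prod_le
    (g := fun α => (α + 1 : ℝ)) (fun _ => by positivity) (fun δ hδ => by
      refine ⟨1 + 1 / δ, fun α => ?_⟩
      have h1 := one_add_mul_le_pow (a := δ) (by linarith) α
      have h2 : (1 : ℝ) ≤ (1 + δ) ^ α := one_le_pow₀ (by linarith)
      have h3 : (α : ℝ) ≤ 1 / δ * (1 + δ) ^ α := by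
        rw [one_div, ← div_eq_inv_mul, le_div_iff₀ hδ]; linarith
      linarith) hε
  refine ⟨K, hK, fun n hn => ?_⟩
  rw [Nat.card_divisors hn]
  simpa [Finsupp.prod] using h n hn

lemma abelianCount_pos (n : ℕ) : 0 < abelianCount n := by
  unfold abelianCount Finsupp.prod
  exact Finset.prod_pos fun _ _ => Fintype.card_pos

lemma abelianCount_one : abelianCount 1 = 1 := by simp [abelianCount]

lemma abelianCount_prime {p : ℕ} (hp : p.Prime) : abelianCount p = 1 := by
  rw [abelianCount, hp.factorization, Finsupp.prod_single_index] <;> simp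

lemma abelianCount_mul {m n : ℕ} (h : m.Coprime n) :
    abelianCount (m * n) = abelianCount m * abelianCount n := by
  rw [abelianCount, Nat.factorization_mul_of_coprime h,
    Finsupp.prod_add_index_of_disjoint h.disjoint_primeFactors]
  rfl

/-- `abelianCount` as a real-valued arithmetic function. -/
noncomputable def abelianCountFn : ArithmeticFunction ℝ :=
  ⟨fun n => if n = 0 then 0 else (abelianCount n : ℝ), by simp⟩

lemma abelianCountFn_apply {n : ℕ} (hn : n ≠ 0) : abelianCountFn n = abelianCount n :=
  if_neg hn

open ArithmeticFunction in
/-- The Dirichlet convolution of `μ` with `abelianCount`, a function supported on the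
squarefull integers. -/
noncomputable def abelianCoeff : ArithmeticFunction ℝ :=
  (moebius : ArithmeticFunction ℝ) * abelianCountFn

open ArithmeticFunction in
lemma sum_divisors_abelianCoeff {n : ℕ} (hn : n ≠ 0) :
    ∑ k ∈ n.divisors, abelianCoeff k = abelianCount n := by
  rw [← coe_zeta_mul_apply, abelianCoeff, ← mul_assoc, coe_zeta_mul_coe_moebius, one_mul,
    abelianCountFn_apply hn]

open ArithmeticFunction in
lemma abelianCoeff_isMultiplicative : abelianCoeff.IsMultiplicative := by
  refine IsMultiplicative.mul isMultiplicative_moebius.intCast ?_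
  rw [IsMultiplicative.iff_ne_zero]
  refine ⟨by simp [abelianCountFn_apply, abelianCount_one], fun {m n} hm hn h => ?_⟩
  simp [abelianCountFn_apply, hm, hn, abelianCount_mul h]

open ArithmeticFunction in
lemma abelianCoeff_prime {p : ℕ} (hp : p.Prime) : abelianCoeff p = 0 := by
  have h := sum_divisors_abelianCoeff hp.ne_zero
  rw [hp.sum_divisors, abelianCount_prime hp, abelianCoeff_isMultiplicative.1] at h
  push_cast at h
  linarith

lemma squarefull_of_abelianCoeff_ne_zero {k : ℕ} (h : abelianCoeff k ≠ 0) : Squarefull k := by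
  intro p hp hpk
  by_contra hsq
  obtain ⟨m, rfl⟩ := hpk
  have hcop : p.Coprime m := by
    rw [hp.coprime_iff_not_dvd]
    rintro ⟨l, rfl⟩
    exact hsq ⟨l, by ring⟩
  exact h (by rw [abelianCoeff_isMultiplicative.2 hcop, abelianCoeff_prime hp, zero_mul])

open ArithmeticFunction in
lemma exists_abs_abelianCoeff_le {ε : ℝ} (hε : 0 < ε) :
    ∃ K : ℝ, 0 < K ∧ ∀ n : ℕ, n ≠ 0 → |abelianCoeff n| ≤ K * (n : ℝ) ^ ε := by
  obtain ⟨K₁, hK₁, h₁⟩ := exists_abelianCount_le (half_pos hε)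
  obtain ⟨K₂, hK₂, h₂⟩ := exists_card_divisors_le (half_pos hε)
  refine ⟨K₂ * K₁, by positivity, fun n hn => ?_⟩
  have hn' : (0 : ℝ) < n := by positivity
  rw [abelianCoeff, mul_apply]
  calc |_| ≤ ∑ x ∈ n.divisorsAntidiagonal, K₁ * (n : ℝ) ^ (ε / 2) := by
        refine (Finset.abs_sum_le_sum_abs _ _).trans (Finset.sum_le_sum fun x hx => ?_)
        obtain ⟨hx, -⟩ := Nat.mem_divisorsAntidiagonal.mp hx
        have hx2 : x.2 ≠ 0 := by rintro h; simp [h] at hx; omega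
        have hμ : |((moebius x.1 : ℤ) : ℝ)| ≤ 1 := by exact_mod_cast abs_moebius_le_one
        have ha := h₁ x.2 hx2
        have hle : (x.2 : ℝ) ≤ n := by
          exact_mod_cast Nat.le_of_dvd (by omega) ⟨x.1, by rw [← hx, mul_comm]⟩
        rw [abs_mul, intCoe_apply]
        rw [abelianCountFn_apply hx2, Nat.abs_cast]
        calc _ ≤ 1 * (K₁ * (x.2 : ℝ) ^ (ε / 2)) := by gcongr
          _ ≤ _ := by rw [one_mul]; gcongr
    _ = n.divisors.card * (K₁ * (n : ℝ) ^ (ε / 2)) := by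
        rw [Finset.sum_const, nsmul_eq_mul, ← Nat.map_div_right_divisors, Finset.card_map]
    _ ≤ (K₂ * (n : ℝ) ^ (ε / 2)) * (K₁ * (n : ℝ) ^ (ε / 2)) := by
        gcongr
        exact h₂ n hn
    _ = K₂ * K₁ * (n : ℝ) ^ ε := by
        conv_rhs => rw [← add_halves ε, Real.rpow_add hn']
        ring

lemma Squarefull.exists_sq_mul_cube {s : ℕ} (h : Squarefull s) : ∃ u v : ℕ, s = u ^ 2 * v ^ 3 := by
  obtain ⟨a, b, hab, ha⟩ := Nat.sq_mul_squarefree s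
  have hdvd : a ∣ b := by
    rw [← Nat.prod_primeFactors_of_squarefree ha]
    refine Finset.prod_primes_dvd _ (fun p hp => (Nat.prime_of_mem_primeFactors hp).prime)
      fun p hp => ?_
    have hpp := Nat.prime_of_mem_primeFactors hp
    by_contra hpb
    have h1 : p ^ 2 ∣ b ^ 2 * a := by
      rw [hab]
      exact h p hpp (by rw [← hab]; exact (Nat.dvd_of_mem_primeFactors hp).mul_left _)
    have h2 : p ^ 2 ∣ a := by
      refine Nat.Coprime.dvd_of_dvd_mul_left ?_ h1
      exact Nat.Coprime.pow _ _ ((hpp.coprime_iff_not_dvd).mpr hpb)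
    rw [sq] at h2
    exact hpp.not_isUnit (ha p h2)
  obtain ⟨u, rfl⟩ := hdvd
  exact ⟨u, a, by rw [← hab]; ring⟩

open scoped Classical in
lemma summable_squarefull_rpow {σ : ℝ} (hσ : 1 / 2 < σ) :
    Summable fun s : ℕ => if s ≠ 0 ∧ Squarefull s then (s : ℝ) ^ (-σ) else 0 := by
  have h1 : Summable fun u : ℕ => (u : ℝ) ^ (-(2 * σ)) :=
    Real.summable_nat_rpow.mpr (by linarith)
  have h2 : Summable fun u : ℕ => (u : ℝ) ^ (-(3 * σ)) :=
    Real.summable_nat_rpow.mpr (by linarith)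
  have h3 := h1.mul_of_nonneg h2 (fun _ => by positivity) (fun _ => by positivity)
  have hex : ∀ s : {s : ℕ // s ≠ 0 ∧ Squarefull s}, ∃ x : ℕ × ℕ, s.1 = x.1 ^ 2 * x.2 ^ 3 := by
    intro s
    obtain ⟨u, v, h⟩ := s.2.2.exists_sq_mul_cube
    exact ⟨(u, v), h⟩
  choose φ hφ using hex
  have hinj : Function.Injective φ := by
    intro s t h
    ext
    rw [hφ s, hφ t, h]
  have h4 := h3.comp_injective hinj
  have h5 : Summable (Set.indicator {s : ℕ | s ≠ 0 ∧ Squarefull s} fun s => (s : ℝ) ^ (-σ)) := by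
    rw [← summable_subtype_iff_indicator]
    refine h4.congr fun s => ?_
    simp only [Function.comp]
    conv_rhs => rw [hφ s]
    push_cast
    rw [Real.mul_rpow (by positivity) (by positivity), ← Real.rpow_natCast, ← Real.rpow_natCast,
      ← Real.rpow_mul (by positivity), ← Real.rpow_mul (by positivity)]
    norm_num
  refine h5.congr fun s => ?_
  simp [Set.indicator]

lemma summable_abs_abelianCoeff_rpow {σ : ℝ} (hσ : 1 / 2 < σ) :
    Summable fun k : ℕ => |abelianCoeff k| * (k : ℝ) ^ (-σ) := by
  obtain ⟨K, hK, h⟩ := exists_abs_abelianCoeff_le (ε := (σ - 1 / 2) / 2) (by linarith)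
  refine Summable.of_nonneg_of_le (fun _ => by positivity) (fun k => ?_)
    ((summable_squarefull_rpow (σ := σ - (σ - 1 / 2) / 2) (by linarith)).mul_left K)
  by_cases hb : abelianCoeff k = 0
  · rw [hb, abs_zero, zero_mul]
    split_ifs <;> positivity
  · have hk : k ≠ 0 := by rintro rfl; simp at hb
    rw [if_pos ⟨hk, squarefull_of_abelianCoeff_ne_zero hb⟩]
    calc |abelianCoeff k| * (k : ℝ) ^ (-σ)
        ≤ (K * (k : ℝ) ^ ((σ - 1 / 2) / 2)) * (k : ℝ) ^ (-σ) := by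
          gcongr
          exact h k hk
      _ = _ := by
          rw [mul_assoc, ← Real.rpow_add (by positivity)]
          congr 2
          ring

open scoped Classical in
lemma summable_squarefull_pair_rpow {σ : ℝ} (hσ : 1 / 2 < σ) :
    Summable fun z : ℕ × ℕ => if z.1 ≠ 0 ∧ Squarefull z.1 ∧ z.2 ≠ 0 then
      ((z.2 ^ 2 * z.1 : ℕ) : ℝ) ^ (-σ) else 0 := by
  have h1 : Summable fun u : ℕ => (u : ℝ) ^ (-(2 * σ)) :=
    Real.summable_nat_rpow.mpr (by linarith)
  have h3 := (summable_squarefull_rpow hσ).mul_of_nonneg h1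
    (fun _ => by dsimp only; split_ifs <;> positivity) (fun _ => by positivity)
  refine Summable.of_nonneg_of_le (fun _ => by split_ifs <;> positivity) (fun z => ?_) h3
  split_ifs with h h' h'
  · push_cast
    rw [Real.mul_rpow (by positivity) (by positivity), ← Real.rpow_natCast,
      ← Real.rpow_mul (by positivity), mul_comm]
    norm_num
  · exact absurd ⟨h.1, h.2.1⟩ h'
  · positivity
  · simp

/-- The number of residues `n` modulo `k` with `k ∣ Q * n + r`. -/
def residueCount (k Q r : ℕ) : ℕ := if k.gcd Q ∣ r then k.gcd Q else 0

lemma residueCount_le {r : ℕ} (hr : 0 < r) (k Q : ℕ) : residueCount k Q r ≤ r := by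
  unfold residueCount
  split_ifs with h
  · exact Nat.le_of_dvd hr h
  · exact r.zero_le

lemma exists_dvd_mul_add {k Q r : ℕ} (hk : 0 < k) (h : k.gcd Q ∣ r) : ∃ v : ℕ, k ∣ Q * v + r := by
  obtain ⟨t, rfl⟩ := h
  have hb := Nat.gcd_eq_gcd_ab k Q
  refine ⟨((-(k.gcdB Q) * t) % k).toNat, ?_⟩
  have hk' : (k : ℤ) ≠ 0 := by exact_mod_cast hk.ne'
  rw [← Int.natCast_dvd_natCast]
  push_cast
  rw [Int.toNat_of_nonneg (Int.emod_nonneg _ hk'), hb]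
  have h1 : (-(k.gcdB Q) * t) % k = -(k.gcdB Q) * t - k * ((-(k.gcdB Q) * t) / k) := by
    have := Int.emod_add_mul_ediv (-(k.gcdB Q) * t) k
    linarith
  rw [h1]
  exact ⟨k.gcdA Q * t - Q * ((-(k.gcdB Q) * t) / k), by ring⟩

lemma abs_card_filter_modEq_sub_le {m : ℕ} (hm : 0 < m) (M v : ℕ) :
    |(((Finset.Icc 1 M).filter (fun n => n ≡ v [MOD m])).card : ℝ) - M / m| ≤ 1 := by
  have h := Nat.Ioc_filter_modEq_card 0 M hm v
  rw [show Finset.Ioc 0 M = Finset.Icc 1 M from rfl] at h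
  have h' : ((((Finset.Icc 1 M).filter (fun n => n ≡ v [MOD m])).card : ℤ) : ℚ) =
      max ((⌊((M : ℚ) - v) / m⌋ : ℚ) - ⌊(((0 : ℕ) : ℚ) - v) / m⌋) 0 := by
    rw [h]; push_cast; rfl
  have key : |(((Finset.Icc 1 M).filter (fun n => n ≡ v [MOD m])).card : ℚ) - M / m| ≤ 1 := by
    rw [Int.cast_natCast] at h'
    rw [h']
    have a1 := Int.floor_le (((M : ℚ) - v) / m)
    have a2 := Int.lt_floor_add_one (((M : ℚ) - v) / m)
    have a3 := Int.floor_le ((((0 : ℕ) : ℚ) - v) / m)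
    have a4 := Int.lt_floor_add_one ((((0 : ℕ) : ℚ) - v) / m)
    have a5 : (0 : ℚ) ≤ M / m := by positivity
    rw [sub_div] at a1 a2 a3 a4
    rw [sub_div, sub_div]
    simp only [Nat.cast_zero, zero_div] at *
    rw [abs_le]
    rcases max_cases ((⌊(M : ℚ) / m - v / m⌋ : ℚ) - ⌊(0 : ℚ) - v / m⌋) 0 with ⟨e, _⟩ | ⟨e, _⟩ <;>
      rw [e] <;> constructor <;> linarith
  have key' := (Rat.cast_le (K := ℝ)).mpr key
  push_cast at key'
  exact key'

lemma abs_card_filter_dvd_sub_le {k : ℕ} (hk : 0 < k) (Q r : ℕ) {Z : ℝ} (hZ : 0 ≤ Z) :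
    |(((Finset.Icc 1 ⌊Z⌋₊).filter (fun n => k ∣ Q * n + r)).card : ℝ) -
      Z * residueCount k Q r / k| ≤ 2 := by
  by_cases h : k.gcd Q ∣ r
  · obtain ⟨v, hv⟩ := exists_dvd_mul_add hk h
    have hg : 0 < k.gcd Q := Nat.gcd_pos_of_pos_left _ hk
    have hm : 0 < k / k.gcd Q := Nat.div_pos (Nat.gcd_le_left Q hk) hg
    have hiff : ∀ n, k ∣ Q * n + r ↔ n ≡ v [MOD k / k.gcd Q] := by
      intro n
      constructor
      · intro hn
        refine Nat.ModEq.cancel_left_div_gcd hk (c := Q) ?_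
        refine Nat.ModEq.add_right_cancel' r ?_
        exact ((Nat.modEq_zero_iff_dvd).mpr hn).trans ((Nat.modEq_zero_iff_dvd).mpr hv).symm
      · intro hn
        have h1 : Q * n ≡ Q * v [MOD k] := by
          have h2 := hn.mul_left' (k.gcd Q)
          rw [Nat.mul_div_cancel' (Nat.gcd_dvd_left k Q)] at h2
          obtain ⟨c, hc⟩ := Nat.gcd_dvd_right k Q
          have h3 := h2.mul_left c
          have h4 : ∀ w, Q * w = c * (k.gcd Q * w) := by
            intro w
            conv_lhs => rw [hc]
            ring
          rw [h4, h4]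
          exact h3
        exact (Nat.modEq_zero_iff_dvd).mp
          ((h1.add_right r).trans ((Nat.modEq_zero_iff_dvd).mpr hv))
    simp_rw [hiff]
    have h1 := abs_card_filter_modEq_sub_le hm ⌊Z⌋₊ v
    have hk' : (0 : ℝ) < k := by exact_mod_cast hk
    have hg' : (0 : ℝ) < k.gcd Q := by exact_mod_cast hg
    have h2 : (((k / k.gcd Q : ℕ)) : ℝ) = k / k.gcd Q :=
      Nat.cast_div (Nat.gcd_dvd_left k Q) hg'.ne'
    rw [h2, div_div_eq_mul_div] at h1
    have h3 : residueCount k Q r = k.gcd Q := if_pos h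
    rw [h3]
    have h4 : |(⌊Z⌋₊ : ℝ) * (k.gcd Q) / k - Z * k.gcd Q / k| ≤ 1 := by
      have e : (⌊Z⌋₊ : ℝ) * (k.gcd Q) / k - Z * k.gcd Q / k = (⌊Z⌋₊ - Z) * (k.gcd Q / k) := by ring
      rw [e, abs_mul]
      have b1 : |(⌊Z⌋₊ : ℝ) - Z| ≤ 1 := by
        rw [abs_le]
        have := Nat.floor_le hZ
        have := Nat.lt_floor_add_one Z
        constructor <;> linarith
      have b2 : |(k.gcd Q : ℝ) / k| ≤ 1 := by
        rw [abs_of_nonneg (by positivity), div_le_one hk']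
        exact_mod_cast Nat.gcd_le_left Q hk
      exact mul_le_one₀ b1 (abs_nonneg _) b2
    calc _ ≤ _ := abs_sub_le _ _ _
      _ ≤ 1 + 1 := add_le_add h1 h4
      _ = 2 := by norm_num
  · have h1 : (Finset.Icc 1 ⌊Z⌋₊).filter (fun n => k ∣ Q * n + r) = ∅ := by
      rw [Finset.filter_eq_empty_iff]
      intro n _ hn
      exact h ((Nat.dvd_add_right ((Nat.gcd_dvd_right k Q).mul_right n)).mp
        ((Nat.gcd_dvd_left k Q).trans hn))
    rw [h1, residueCount, if_neg h]
    simp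

/-- Möbius inversion for a sum over the integers coprime to `s`. -/
lemma sum_coprime_eq_sum_moebius {s : ℕ} (hs : s ≠ 0) (f : ℕ → ℝ) (N : ℕ) :
    ∑ n ∈ (Finset.Icc 1 N).filter (fun n => n.gcd s = 1), f n =
      ∑ e ∈ s.divisors, (ArithmeticFunction.moebius e : ℝ) *
        ∑ n ∈ Finset.Icc 1 (N / e), f (e * n) := by
  have h1 : ∀ n ∈ Finset.Icc 1 N, (if n.gcd s = 1 then f n else 0) =
      ∑ e ∈ s.divisors, if e ∣ n then (ArithmeticFunction.moebius e : ℝ) * f n else 0 := by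
    intro n hn
    have hn0 : n ≠ 0 := by simp at hn; omega
    have h2 : (n.gcd s).divisors = s.divisors.filter (· ∣ n) := by
      ext e
      simp only [Nat.mem_divisors, Finset.mem_filter, Nat.dvd_gcd_iff]
      constructor
      · rintro ⟨⟨a, b⟩, -⟩; exact ⟨⟨b, hs⟩, a⟩
      · rintro ⟨⟨a, -⟩, b⟩; exact ⟨⟨b, a⟩, Nat.gcd_ne_zero_left hn0⟩
    rw [← Finset.sum_filter, ← h2, ← Finset.sum_mul, ← Int.cast_sum,
      ← ArithmeticFunction.coe_mul_zeta_apply, ArithmeticFunction.moebius_mul_coe_zeta,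
      ArithmeticFunction.one_apply]
    split_ifs <;> simp
  rw [Finset.sum_filter, Finset.sum_congr rfl h1, Finset.sum_comm]
  refine Finset.sum_congr rfl fun e he => ?_
  have he0 : 0 < e := Nat.pos_of_mem_divisors he
  rw [← Finset.sum_filter, Finset.mul_sum]
  symm
  refine Finset.sum_bij (fun n _ => e * n) ?_ ?_ ?_ ?_
  · intro n hn
    simp only [Finset.mem_Icc, Finset.mem_filter] at hn ⊢
    refine ⟨⟨Nat.mul_pos he0 hn.1, ?_⟩, dvd_mul_right _ _⟩
    rw [mul_comm]
    exact (Nat.le_div_iff_mul_le he0).mp hn.2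
  · intro a _ b _ h
    exact Nat.eq_of_mul_eq_mul_left he0 h
  · intro n hn
    simp only [Finset.mem_Icc, Finset.mem_filter] at hn
    obtain ⟨⟨h1, h2⟩, m, rfl⟩ := hn
    refine ⟨m, ?_, rfl⟩
    simp only [Finset.mem_Icc]
    exact ⟨Nat.pos_of_mul_pos_left h1, (Nat.le_div_iff_mul_le he0).mpr (by rwa [mul_comm])⟩
  · intro _ _
    rfl

/-- The sum of `abelianCount` over the progression `q * n + abelianCount s` with `q * n ≤ x` and
`n` coprime to `s`. -/
noncomputable def progSum (q s : ℕ) (x : ℝ) : ℝ :=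
  ∑ n ∈ (Finset.Icc 1 ⌊x / q⌋₊).filter (fun n => n.gcd s = 1),
    (abelianCount (q * n + abelianCount s) : ℝ)

/-- The local weight attached to the divisor `k` in the mean value of `progSum q s`. -/
noncomputable def progWeight (q s k : ℕ) : ℝ :=
  ∑ e ∈ s.divisors, (ArithmeticFunction.moebius e : ℝ) / e *
    residueCount k (q * e) (abelianCount s)

/-- The mean value of `progSum q s x` as `x → ∞`. -/
noncomputable def progDensity (q s : ℕ) : ℝ :=
  (∑' k : ℕ, abelianCoeff k * progWeight q s k / k) / q

lemma abs_moebius_cast_le_one (n : ℕ) : |(ArithmeticFunction.moebius n : ℝ)| ≤ 1 := by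
  exact_mod_cast ArithmeticFunction.abs_moebius_le_one (n := n)

lemma abs_progWeight_le (q s k : ℕ) :
    |progWeight q s k| ≤ s.divisors.card * abelianCount s := by
  rw [progWeight, ← nsmul_eq_mul]
  refine (Finset.abs_sum_le_sum_abs _ _).trans (Finset.sum_le_card_nsmul _ _ _ fun e he => ?_)
  have he0 : (1 : ℝ) ≤ e := by exact_mod_cast Nat.pos_of_mem_divisors he
  rw [abs_mul, abs_div, Nat.abs_cast, Nat.abs_cast]
  have h1 : |(ArithmeticFunction.moebius e : ℝ)| / e ≤ 1 :=
    div_le_one_of_le₀ ((abs_moebius_cast_le_one e).trans he0) (by linarith)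
  have h2 : (residueCount k (q * e) (abelianCount s) : ℝ) ≤ abelianCount s := by
    exact_mod_cast residueCount_le (abelianCount_pos s) _ _
  calc _ ≤ 1 * (abelianCount s : ℝ) := by gcongr
    _ = _ := one_mul _

lemma progSum_eq {q s : ℕ} (hq : 0 < q) (hs : s ≠ 0) (x : ℝ) :
    progSum q s x = ∑ k ∈ Finset.Icc 1 (⌊x⌋₊ + abelianCount s), abelianCoeff k *
      ∑ e ∈ s.divisors, (ArithmeticFunction.moebius e : ℝ) *
        ((Finset.Icc 1 ⌊x / q / e⌋₊).filter
          (fun n => k ∣ q * e * n + abelianCount s)).card := by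
  have h1 : ∀ n ∈ (Finset.Icc 1 ⌊x / q⌋₊).filter (fun n => n.gcd s = 1),
      (abelianCount (q * n + abelianCount s) : ℝ) =
        ∑ k ∈ Finset.Icc 1 (⌊x⌋₊ + abelianCount s),
          abelianCoeff k * if k ∣ q * n + abelianCount s then 1 else 0 := by
    intro n hn
    simp only [Finset.mem_filter, Finset.mem_Icc] at hn
    have hr := abelianCount_pos s
    have hle : q * n ≤ ⌊x⌋₊ := by
      have h2 := hn.1.2
      rw [Nat.floor_div_natCast] at h2
      rw [mul_comm]
      exact (Nat.le_div_iff_mul_le hq).mp h2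
    rw [← sum_divisors_abelianCoeff (by omega)]
    simp only [mul_ite, mul_one, mul_zero]
    rw [← Finset.sum_filter]
    refine Finset.sum_congr ?_ fun _ _ => rfl
    ext k
    simp only [Nat.mem_divisors, Finset.mem_filter, Finset.mem_Icc]
    constructor
    · rintro ⟨h3, h4⟩
      have := Nat.le_of_dvd (by omega) h3
      exact ⟨⟨Nat.pos_of_dvd_of_pos h3 (by omega), by omega⟩, h3⟩
    · rintro ⟨-, h3⟩
      exact ⟨h3, by omega⟩
  rw [progSum, Finset.sum_congr rfl h1, Finset.sum_comm]
  refine Finset.sum_congr rfl fun k _ => ?_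
  rw [← Finset.mul_sum, sum_coprime_eq_sum_moebius hs]
  congr 1
  refine Finset.sum_congr rfl fun e _ => ?_
  rw [Finset.sum_boole, ← Nat.floor_div_natCast]
  simp only [mul_assoc]

lemma abs_sum_moebius_mul_card_sub_le {q s k : ℕ} (hk : 0 < k) {x : ℝ} (hx : 0 ≤ x) :
    |∑ e ∈ s.divisors, (ArithmeticFunction.moebius e : ℝ) *
        ((Finset.Icc 1 ⌊x / q / e⌋₊).filter
          (fun n => k ∣ q * e * n + abelianCount s)).card - x / q * progWeight q s k / k| ≤
      2 * s.divisors.card := by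
  rw [progWeight, Finset.mul_sum, Finset.sum_div, ← Finset.sum_sub_distrib, mul_comm (2 : ℝ),
    ← nsmul_eq_mul]
  refine (Finset.abs_sum_le_sum_abs _ _).trans (Finset.sum_le_card_nsmul _ _ _ fun e he => ?_)
  have h := abs_card_filter_dvd_sub_le hk (q * e) (abelianCount s) (Z := x / q / e) (by positivity)
  have h1 : ∀ m c R : ℝ, m * c - x / q * (m / e * R) / k = m * (c - x / q / e * R / k) := by
    intro m c R; ring
  rw [h1, abs_mul]
  calc _ ≤ 1 * (2 : ℝ) := mul_le_mul (abs_moebius_cast_le_one e) h (abs_nonneg _) zero_le_one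
    _ = 2 := one_mul _

lemma abs_abelianCoeff_mul_progWeight_div_le (q s k : ℕ) :
    |abelianCoeff k * progWeight q s k / k| ≤
      s.divisors.card * abelianCount s * (|abelianCoeff k| * (k : ℝ) ^ (-1 : ℝ)) := by
  rw [abs_div, abs_mul, Nat.abs_cast, Real.rpow_neg_one, div_eq_mul_inv]
  calc _ ≤ |abelianCoeff k| * (s.divisors.card * abelianCount s) * (k : ℝ)⁻¹ := by
        gcongr
        exact abs_progWeight_le q s k
    _ = _ := by ring

lemma summable_abelianCoeff_mul_progWeight_div (q s : ℕ) :
    Summable fun k : ℕ => abelianCoeff k * progWeight q s k / k :=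
  Summable.of_norm_bounded
    ((summable_abs_abelianCoeff_rpow (σ := 1) (by norm_num)).mul_left _)
    (abs_abelianCoeff_mul_progWeight_div_le q s)

lemma exists_abs_progDensity_le {ε : ℝ} (hε : 0 < ε) :
    ∃ K : ℝ, 0 < K ∧ ∀ q s : ℕ, s ≠ 0 → s ≤ q → |progDensity q s| ≤ K * (q : ℝ) ^ (-1 + ε) := by
  obtain ⟨K₁, hK₁, h₁⟩ := exists_abelianCount_le (half_pos hε)
  obtain ⟨K₂, hK₂, h₂⟩ := exists_card_divisors_le (half_pos hε)
  have hB := summable_abs_abelianCoeff_rpow (σ := 1) (by norm_num)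
  set B := ∑' k : ℕ, |abelianCoeff k| * (k : ℝ) ^ (-1 : ℝ)
  have hB0 : 0 ≤ B := tsum_nonneg fun _ => by positivity
  refine ⟨K₂ * K₁ * (B + 1), by positivity, fun q s hs hsq => ?_⟩
  have hq : (0 : ℝ) < q := by exact_mod_cast (by omega : 0 < q)
  have hs' : (s : ℝ) ≤ q := by exact_mod_cast hsq
  have h3 := (summable_abelianCoeff_mul_progWeight_div q s).hasSum.norm_le_of_bounded
    (hB.hasSum.mul_left (s.divisors.card * abelianCount s : ℝ))
    (abs_abelianCoeff_mul_progWeight_div_le q s)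
  rw [Real.norm_eq_abs] at h3
  rw [progDensity, abs_div, Nat.abs_cast, div_le_iff₀ hq]
  refine h3.trans ?_
  calc (s.divisors.card * abelianCount s * B : ℝ)
      ≤ (K₂ * (q : ℝ) ^ (ε / 2)) * (K₁ * (q : ℝ) ^ (ε / 2)) * (B + 1) := by
        gcongr
        · exact (h₂ s hs).trans (by gcongr)
        · exact (h₁ s hs).trans (by gcongr)
        · linarith
    _ = K₂ * K₁ * (B + 1) * (q : ℝ) ^ (-1 + ε) * q := by
        have e1 : (q : ℝ) ^ (-1 + ε) * q = (q : ℝ) ^ (ε / 2) * (q : ℝ) ^ (ε / 2) := by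
          rw [← Real.rpow_add hq, ← Real.rpow_add_one hq.ne']
          congr 1
          ring
        rw [mul_assoc _ _ (q : ℝ), e1]
        ring

lemma progSum_nonneg (q s : ℕ) (x : ℝ) : 0 ≤ progSum q s x :=
  Finset.sum_nonneg fun _ _ => by positivity

lemma exists_progSum_le {ε : ℝ} (hε : 0 < ε) :
    ∃ K : ℝ, 0 < K ∧ ∀ q s : ℕ, ∀ x : ℝ, s ≠ 0 → s ≤ q → (q : ℝ) ≤ x →
      progSum q s x ≤ K * x ^ (1 + ε) / q := by
  obtain ⟨K₁, hK₁, h₁⟩ := exists_abelianCount_le hε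
  obtain ⟨K₂, hK₂, h₂⟩ := exists_abelianCount_le one_pos
  refine ⟨K₁ * (1 + K₂) ^ ε, by positivity, fun q s x hs hsq hqx => ?_⟩
  have hq : (0 : ℝ) < q := by exact_mod_cast (by omega : 0 < q)
  have hx : 0 < x := hq.trans_le hqx
  have hsx : (s : ℝ) ≤ x := le_trans (by exact_mod_cast hsq) hqx
  have hterm : ∀ n ∈ (Finset.Icc 1 ⌊x / q⌋₊).filter (fun n => n.gcd s = 1),
      (abelianCount (q * n + abelianCount s) : ℝ) ≤ K₁ * ((1 + K₂) * x) ^ ε := by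
    intro n hn
    simp only [Finset.mem_filter, Finset.mem_Icc] at hn
    have hr := abelianCount_pos s
    have hn2 : (n : ℝ) ≤ x / q := (Nat.le_floor_iff (by positivity)).mp hn.1.2
    refine (h₁ _ (by omega)).trans ?_
    gcongr
    push_cast
    have h3 := h₂ s hs
    rw [Real.rpow_one] at h3
    have h4 : (q : ℝ) * n ≤ x := by rw [mul_comm]; exact (le_div_iff₀ hq).mp hn2
    nlinarith
  calc progSum q s x ≤ ((Finset.Icc 1 ⌊x / q⌋₊).filter (fun n => n.gcd s = 1)).card •
          (K₁ * ((1 + K₂) * x) ^ ε) := Finset.sum_le_card_nsmul _ _ _ hterm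
    _ ≤ (x / q) * (K₁ * ((1 + K₂) * x) ^ ε) := by
        rw [nsmul_eq_mul]
        gcongr
        refine le_trans ?_ (Nat.floor_le (by positivity : 0 ≤ x / q))
        have := Finset.card_filter_le (Finset.Icc 1 ⌊x / q⌋₊) (fun n => n.gcd s = 1)
        rw [Nat.card_Icc, Nat.add_sub_cancel] at this
        exact_mod_cast this
    _ = _ := by
        rw [Real.mul_rpow (by positivity) hx.le, Real.rpow_add hx, Real.rpow_one]
        ring

lemma abs_progSum_sub_le {q s : ℕ} (hq : 0 < q) (hs : s ≠ 0) {x δ : ℝ} (hx : 1 ≤ x)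
    (hδ : 0 < δ) (hδ2 : δ ≤ 1 / 2) :
    |progSum q s x - x * progDensity q s| ≤
      (2 * s.divisors.card * (x + abelianCount s) ^ (1 / 2 + δ) +
        s.divisors.card * abelianCount s * x ^ (1 / 2 + δ)) *
        ∑' k : ℕ, |abelianCoeff k| * (k : ℝ) ^ (-(1 / 2 + δ)) := by
  have hx0 : 0 < x := by linarith
  have hB := summable_abs_abelianCoeff_rpow (σ := 1 / 2 + δ) (by linarith)
  set X : ℕ := ⌊x⌋₊ + abelianCount s with hX
  set c : ℕ → ℝ := fun k => ∑ e ∈ s.divisors, (ArithmeticFunction.moebius e : ℝ) *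
    ((Finset.Icc 1 ⌊x / q / e⌋₊).filter (fun n => k ∣ q * e * n + abelianCount s)).card with hc
  have hr : (1 : ℝ) ≤ abelianCount s := by exact_mod_cast abelianCount_pos s
  have hXx : x ≤ X := by
    rw [hX]; push_cast
    have := Nat.lt_floor_add_one x
    linarith
  have hXx' : (X : ℝ) ≤ x + abelianCount s := by
    rw [hX]; push_cast
    have := Nat.floor_le hx0.le
    linarith
  have hs1 : HasSum (fun k => if k ∈ Finset.Icc 1 X then abelianCoeff k * c k else 0)
      (progSum q s x) := by
    rw [progSum_eq hq hs x, ← hX, Finset.sum_congr rfl (fun k hk => (if_pos hk).symm)]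
    exact hasSum_sum_of_ne_finset_zero (fun k hk => if_neg hk)
  have hs2 : HasSum (fun k : ℕ => x / q * (abelianCoeff k * progWeight q s k / k))
      (x * progDensity q s) := by
    have := (summable_abelianCoeff_mul_progWeight_div q s).hasSum.mul_left (x / q)
    rwa [show x / q * ∑' k : ℕ, abelianCoeff k * progWeight q s k / k = x * progDensity q s by
      rw [progDensity]; ring] at this
  refine (hs1.sub hs2).norm_le_of_bounded (hB.hasSum.mul_left _) fun k => ?_
  rw [Real.norm_eq_abs]
  rcases Nat.eq_zero_or_pos k with rfl | hk
  · simp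
  have hk' : (0 : ℝ) < k := by exact_mod_cast hk
  have hxq : x / q ≤ x := div_le_self hx0.le (by exact_mod_cast hq)
  split_ifs with h
  · have hkX : (k : ℝ) ≤ X := by exact_mod_cast (Finset.mem_Icc.mp h).2
    have e1 : abelianCoeff k * c k - x / q * (abelianCoeff k * progWeight q s k / k) =
        abelianCoeff k * (c k - x / q * progWeight q s k / k) := by ring
    have h1 : |c k - x / q * progWeight q s k / k| ≤ 2 * s.divisors.card :=
      abs_sum_moebius_mul_card_sub_le hk hx0.le
    have h2 : 1 ≤ (x + abelianCount s) ^ (1 / 2 + δ) * (k : ℝ) ^ (-(1 / 2 + δ)) := by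
      rw [Real.rpow_neg hk'.le, ← div_eq_mul_inv, one_le_div (by positivity)]
      gcongr
      linarith
    rw [e1, abs_mul]
    calc |abelianCoeff k| * |c k - x / q * progWeight q s k / k|
        ≤ |abelianCoeff k| * (2 * s.divisors.card *
          ((x + abelianCount s) ^ (1 / 2 + δ) * (k : ℝ) ^ (-(1 / 2 + δ)))) := by
          gcongr
          exact h1.trans (le_mul_of_one_le_right (by positivity) h2)
      _ = (2 * s.divisors.card * (x + abelianCount s) ^ (1 / 2 + δ)) *
          (|abelianCoeff k| * (k : ℝ) ^ (-(1 / 2 + δ))) := by ring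
      _ ≤ _ := by
          gcongr
          exact le_add_of_nonneg_right (by positivity)
  · have hkX : x ≤ k := by
      rw [Finset.mem_Icc, not_and, not_le] at h
      exact hXx.trans (by exact_mod_cast (h hk).le)
    rw [zero_sub, abs_neg, abs_mul, abs_of_nonneg (by positivity : 0 ≤ x / q)]
    have h3 : x * (k : ℝ) ^ (-1 : ℝ) ≤ x ^ (1 / 2 + δ) * (k : ℝ) ^ (-(1 / 2 + δ)) := by
      have e2 : (k : ℝ) ^ (-1 : ℝ) = (k : ℝ) ^ (-(1 / 2 - δ)) * (k : ℝ) ^ (-(1 / 2 + δ)) := by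
        rw [← Real.rpow_add hk']; congr 1; ring
      have e3 : x * x ^ (-(1 / 2 - δ)) = x ^ (1 / 2 + δ) := by
        rw [mul_comm, ← Real.rpow_add_one hx0.ne']; congr 1; ring
      rw [e2, ← e3, ← mul_assoc]
      gcongr x * ?_ * _
      exact Real.rpow_le_rpow_of_nonpos hx0 hkX (by linarith)
    calc x / q * |abelianCoeff k * progWeight q s k / k|
        ≤ x * (s.divisors.card * abelianCount s * (|abelianCoeff k| * (k : ℝ) ^ (-1 : ℝ))) := by
          gcongr
          exact abs_abelianCoeff_mul_progWeight_div_le q s k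
      _ = s.divisors.card * abelianCount s * |abelianCoeff k| * (x * (k : ℝ) ^ (-1 : ℝ)) := by ring
      _ ≤ s.divisors.card * abelianCount s * |abelianCoeff k| *
          (x ^ (1 / 2 + δ) * (k : ℝ) ^ (-(1 / 2 + δ))) := by gcongr
      _ = (s.divisors.card * abelianCount s * x ^ (1 / 2 + δ)) *
          (|abelianCoeff k| * (k : ℝ) ^ (-(1 / 2 + δ))) := by ring
      _ ≤ _ := by
          gcongr
          exact le_add_of_nonneg_left (by positivity)

lemma exists_abs_progSum_sub_le {ε : ℝ} (hε : 0 < ε) (hε1 : ε ≤ 1) :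
    ∃ K : ℝ, 0 < K ∧ ∀ q s : ℕ, ∀ x : ℝ, s ≠ 0 → s ≤ q → (q : ℝ) ≤ x →
      |progSum q s x - x * progDensity q s| ≤ K * x ^ (1 / 2 + ε) := by
  obtain ⟨δ, hδ⟩ : ∃ δ, δ = ε / 3 := ⟨_, rfl⟩
  have hδ0 : 0 < δ := by linarith
  obtain ⟨K₁, hK₁, h₁⟩ := exists_abelianCount_le hδ0
  obtain ⟨K₂, hK₂, h₂⟩ := exists_card_divisors_le hδ0
  set B := ∑' k : ℕ, |abelianCoeff k| * (k : ℝ) ^ (-(1 / 2 + δ))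
  have hB0 : 0 ≤ B := tsum_nonneg fun _ => by positivity
  refine ⟨(2 * K₂ * (1 + K₁) ^ (1 / 2 + δ) + K₂ * K₁) * (B + 1), by positivity,
    fun q s x hs hsq hqx => ?_⟩
  have hq : 0 < q := by omega
  have hx : 1 ≤ x := le_trans (by exact_mod_cast hq) hqx
  have hx0 : 0 < x := by linarith
  have hsx : (s : ℝ) ≤ x := le_trans (by exact_mod_cast hsq) hqx
  have ha : (abelianCount s : ℝ) ≤ K₁ * x ^ δ := (h₁ s hs).trans (by gcongr)
  have hd : (s.divisors.card : ℝ) ≤ K₂ * x ^ δ := (h₂ s hs).trans (by gcongr)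
  have hxδ : x ^ δ ≤ x := by
    conv_rhs => rw [← Real.rpow_one x]
    exact Real.rpow_le_rpow_of_exponent_le hx (by linarith)
  have hsum : x + abelianCount s ≤ (1 + K₁) * x := by nlinarith
  have hp1 : x ^ δ * x ^ (1 / 2 + δ) ≤ x ^ (1 / 2 + ε) := by
    rw [← Real.rpow_add hx0]
    exact Real.rpow_le_rpow_of_exponent_le hx (by linarith)
  have hp2 : x ^ δ * x ^ δ * x ^ (1 / 2 + δ) = x ^ (1 / 2 + ε) := by
    rw [← Real.rpow_add hx0, ← Real.rpow_add hx0, hδ]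
    congr 1
    ring
  calc _ ≤ _ := abs_progSum_sub_le hq hs hx hδ0 (by linarith)
    _ ≤ (2 * (K₂ * x ^ δ) * ((1 + K₁) * x) ^ (1 / 2 + δ) +
        (K₂ * x ^ δ) * (K₁ * x ^ δ) * x ^ (1 / 2 + δ)) * (B + 1) := by
        gcongr
        linarith
    _ = (2 * K₂ * (1 + K₁) ^ (1 / 2 + δ) * (x ^ δ * x ^ (1 / 2 + δ)) +
        K₂ * K₁ * (x ^ δ * x ^ δ * x ^ (1 / 2 + δ))) * (B + 1) := by
        rw [Real.mul_rpow (by positivity) hx0.le]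
        ring
    _ ≤ (2 * K₂ * (1 + K₁) ^ (1 / 2 + δ) * x ^ (1 / 2 + ε) +
        K₂ * K₁ * x ^ (1 / 2 + ε)) * (B + 1) := by
        rw [hp2]
        gcongr
    _ = _ := by ring

/-- The pairs `(s, d)` of positive coprime integers with `s` squarefull. -/
def IsSquarefullPair (z : ℕ × ℕ) : Prop :=
  z.1 ≠ 0 ∧ Squarefull z.1 ∧ z.2 ≠ 0 ∧ z.2.gcd z.1 = 1

/-- The modulus `d ^ 2 * s` attached to the pair `(s, d)`. -/
def pairModulus (z : ℕ × ℕ) : ℕ := z.2 ^ 2 * z.1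

lemma IsSquarefullPair.le_pairModulus {z : ℕ × ℕ} (hz : IsSquarefullPair z) :
    z.1 ≤ pairModulus z :=
  Nat.le_mul_of_pos_left _ (by have := hz.2.2.1; positivity)

lemma IsSquarefullPair.snd_le_pairModulus {z : ℕ × ℕ} (hz : IsSquarefullPair z) :
    z.2 ≤ pairModulus z := by
  have h1 : 0 < z.2 := Nat.pos_of_ne_zero hz.2.2.1
  have h2 : 0 < z.1 := Nat.pos_of_ne_zero hz.1
  calc z.2 ≤ z.2 ^ 2 := Nat.le_self_pow two_ne_zero _
    _ ≤ z.2 ^ 2 * z.1 := Nat.le_mul_of_pos_right _ h2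

lemma IsSquarefullPair.pairModulus_pos {z : ℕ × ℕ} (hz : IsSquarefullPair z) :
    0 < pairModulus z :=
  (Nat.pos_of_ne_zero hz.1).trans_le hz.le_pairModulus

open scoped Classical in
/-- The pairs with modulus at most `y`. -/
noncomputable def boundedPairs (y : ℝ) : Finset (ℕ × ℕ) :=
  (Finset.Icc 1 ⌊y⌋₊ ×ˢ Finset.Icc 1 ⌊y⌋₊).filter
    fun z => IsSquarefullPair z ∧ (pairModulus z : ℝ) ≤ y

lemma mem_boundedPairs {y : ℝ} {z : ℕ × ℕ} :
    z ∈ boundedPairs y ↔ IsSquarefullPair z ∧ (pairModulus z : ℝ) ≤ y := by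
  simp only [boundedPairs, Finset.mem_filter, Finset.mem_product, Finset.mem_Icc,
    and_iff_right_iff_imp]
  rintro ⟨h, hy⟩
  have hN : pairModulus z ≤ ⌊y⌋₊ := Nat.le_floor hy
  exact ⟨⟨Nat.pos_of_ne_zero h.1, h.le_pairModulus.trans hN⟩,
    Nat.pos_of_ne_zero h.2.2.1, h.snd_le_pairModulus.trans hN⟩

/-- The double sum over squarefull `s` and coprime `d` with `d ^ 2 * s ≤ y`. -/
noncomputable def mainSum (x y : ℝ) : ℝ :=
  ∑ z ∈ boundedPairs y,
    (ArithmeticFunction.moebius z.2 : ℝ) * progSum (pairModulus z) z.1 x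

open scoped Classical in
/-- The leading constant of `mainSum`. -/
noncomputable def mainConst : ℝ :=
  ∑' z : ℕ × ℕ, if IsSquarefullPair z then
    (ArithmeticFunction.moebius z.2 : ℝ) * progDensity (pairModulus z) z.1 else 0

open scoped Classical in
lemma mainSum_eq (x y : ℝ) :
    mainSum x y = ∑ s ∈ (Finset.Icc 1 ⌊y⌋₊).filter Squarefull,
      ∑ d ∈ (Finset.Icc 1 ⌊y⌋₊).filter
          (fun d => ((d ^ 2 * s : ℕ) : ℝ) ≤ y ∧ Nat.gcd d s = 1),
        (ArithmeticFunction.moebius d : ℝ) *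
          ∑ n ∈ (Finset.Icc 1 ⌊x / ((d : ℝ) ^ 2 * (s : ℝ))⌋₊).filter
              (fun n => Nat.gcd n s = 1),
            (abelianCount (d ^ 2 * n * s + abelianCount s) : ℝ) := by
  have h1 : boundedPairs y = (Finset.Icc 1 ⌊y⌋₊ ×ˢ Finset.Icc 1 ⌊y⌋₊).filter
      (fun z => Squarefull z.1 ∧ (((z.2 ^ 2 * z.1 : ℕ) : ℝ) ≤ y ∧ Nat.gcd z.2 z.1 = 1)) := by
    refine Finset.filter_congr fun z hz => ?_
    simp only [Finset.mem_product, Finset.mem_Icc] at hz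
    simp only [IsSquarefullPair, pairModulus]
    constructor
    · rintro ⟨⟨-, h2, -, h3⟩, h4⟩; exact ⟨h2, h4, h3⟩
    · rintro ⟨h2, h4, h3⟩; exact ⟨⟨by omega, h2, by omega, h3⟩, h4⟩
  rw [mainSum, h1, Finset.sum_filter, Finset.sum_product, Finset.sum_filter]
  refine Finset.sum_congr rfl fun s _ => ?_
  split_ifs with hs
  · rw [Finset.sum_filter]
    refine Finset.sum_congr rfl fun d _ => ?_
    simp only [hs, true_and]
    refine if_congr Iff.rfl ?_ rfl
    rw [progSum, pairModulus]
    push_cast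
    congr 1
    refine Finset.sum_congr rfl fun n _ => ?_
    rw [mul_right_comm]
  · exact Finset.sum_eq_zero fun d _ => if_neg fun h => hs h.1

lemma summable_mainConst : Summable fun z : ℕ × ℕ => open scoped Classical in
    if IsSquarefullPair z then
      (ArithmeticFunction.moebius z.2 : ℝ) * progDensity (pairModulus z) z.1 else 0 := by
  classical
  obtain ⟨K, hK, h⟩ := exists_abs_progDensity_le (ε := 1 / 4) (by norm_num)
  refine Summable.of_norm_bounded
    ((summable_squarefull_pair_rpow (σ := 3 / 4) (by norm_num)).mul_left K) fun z => ?_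
  rw [Real.norm_eq_abs]
  by_cases hz : IsSquarefullPair z
  · rw [if_pos hz, if_pos ⟨hz.1, hz.2.1, hz.2.2.1⟩, abs_mul]
    have h1 := h _ _ hz.1 hz.le_pairModulus
    calc _ ≤ 1 * (K * (pairModulus z : ℝ) ^ (-1 + 1 / 4 : ℝ)) :=
          mul_le_mul (abs_moebius_cast_le_one _) h1 (abs_nonneg _) zero_le_one
      _ = _ := by rw [one_mul, pairModulus]; norm_num
  · rw [if_neg hz, abs_zero]
    split_ifs <;> positivity

lemma exists_abs_mainSum_sub_le {σ : ℝ} (hσ : 1 / 2 < σ) :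
    ∃ S : ℝ, 0 < S ∧ ∀ x y D : ℝ, 0 ≤ x → 0 ≤ D →
      (∀ z, IsSquarefullPair z → (pairModulus z : ℝ) ≤ y →
        |progSum (pairModulus z) z.1 x - x * progDensity (pairModulus z) z.1| ≤
          D * (pairModulus z : ℝ) ^ (-σ)) →
      (∀ z, IsSquarefullPair z → y < (pairModulus z : ℝ) →
        x * |progDensity (pairModulus z) z.1| ≤ D * (pairModulus z : ℝ) ^ (-σ)) →
      |mainSum x y - mainConst * x| ≤ S * D := by
  classical
  have hS := summable_squarefull_pair_rpow hσ
  have hS0 : 0 < ∑' z : ℕ × ℕ, if z.1 ≠ 0 ∧ Squarefull z.1 ∧ z.2 ≠ 0 then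
      ((z.2 ^ 2 * z.1 : ℕ) : ℝ) ^ (-σ) else 0 := by
    refine hS.tsum_pos (fun z => by split_ifs <;> positivity) (1, 1) ?_
    rw [if_pos ⟨one_ne_zero, fun p hp h => absurd (Nat.dvd_one.mp h) hp.one_lt.ne', one_ne_zero⟩]
    simp
  refine ⟨_, hS0, fun x y D hx hD h1 h2 => ?_⟩
  have hs1 : HasSum (fun z => if z ∈ boundedPairs y then
      (ArithmeticFunction.moebius z.2 : ℝ) * progSum (pairModulus z) z.1 x else 0)
      (mainSum x y) := by
    rw [mainSum, Finset.sum_congr rfl (fun z hz => (if_pos hz).symm)]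
    exact hasSum_sum_of_ne_finset_zero (fun z hz => if_neg hz)
  have hs2 := summable_mainConst.hasSum.mul_right x
  rw [mul_comm _ D]
  refine (hs1.sub hs2).norm_le_of_bounded (hS.hasSum.mul_left D) fun z => ?_
  rw [Real.norm_eq_abs]
  by_cases hz : IsSquarefullPair z
  · have hz' : z.1 ≠ 0 ∧ Squarefull z.1 ∧ z.2 ≠ 0 := ⟨hz.1, hz.2.1, hz.2.2.1⟩
    rw [if_pos hz', if_pos hz]
    by_cases hy : (pairModulus z : ℝ) ≤ y
    · have hmem : z ∈ boundedPairs y := mem_boundedPairs.mpr ⟨hz, hy⟩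
      rw [if_pos hmem]
      calc _ = |(ArithmeticFunction.moebius z.2 : ℝ)| *
            |progSum (pairModulus z) z.1 x - x * progDensity (pairModulus z) z.1| := by
            rw [← abs_mul]; congr 1; ring
        _ ≤ 1 * _ := mul_le_mul (abs_moebius_cast_le_one _) (h1 z hz hy) (abs_nonneg _) zero_le_one
        _ = _ := one_mul _
    · have hmem : z ∉ boundedPairs y := fun h => hy (mem_boundedPairs.mp h).2
      rw [if_neg hmem]
      calc _ = |(ArithmeticFunction.moebius z.2 : ℝ)| *
            (x * |progDensity (pairModulus z) z.1|) := by
            rw [zero_sub, abs_neg, abs_mul, abs_mul, abs_of_nonneg hx]; ring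
        _ ≤ 1 * _ := mul_le_mul (abs_moebius_cast_le_one _) (h2 z hz (not_le.mp hy))
            (by positivity) zero_le_one
        _ = _ := one_mul _
  · have hmem : z ∉ boundedPairs y := fun h => hz (mem_boundedPairs.mp h).1
    rw [if_neg hz, if_neg hmem, zero_mul, sub_zero, abs_zero]
    split_ifs <;> positivity

lemma exists_abs_mainSum_sub_mainConst_le {ε : ℝ} (hε : 0 < ε) :
    ∃ K : ℝ, 0 < K ∧ ∀ x y : ℝ, 1 ≤ y → y ≤ x →
      |mainSum x y - mainConst * x| ≤
        K * (x ^ (1 + ε) * y ^ (-(1 : ℝ) / 2) + x ^ (1 / 2 + ε) * y ^ ((1 : ℝ) / 2)) := by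
  obtain ⟨δ, hδ0, hδε, hδ1⟩ : ∃ δ : ℝ, 0 < δ ∧ 4 * δ ≤ ε ∧ 4 * δ ≤ 1 :=
    ⟨min ε 1 / 4, by positivity, by linarith [min_le_left ε 1], by linarith [min_le_right ε 1]⟩
  obtain ⟨K₁, hK₁, h₁⟩ := exists_abs_progSum_sub_le hδ0 (by linarith)
  obtain ⟨K₂, hK₂, h₂⟩ := exists_abs_progDensity_le hδ0
  obtain ⟨S, hS, h⟩ := exists_abs_mainSum_sub_le (σ := 1 / 2 + δ) (by linarith)
  refine ⟨S * (K₁ + K₂), by positivity, fun x y hy hyx => ?_⟩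
  have hy0 : 0 < y := by linarith
  have hx1 : 1 ≤ x := hy.trans hyx
  have hx0 : 0 < x := by linarith
  have hmain := h x y (K₁ * x ^ (1 / 2 + δ) * y ^ (1 / 2 + δ) + K₂ * x * y ^ (-(1 / 2) + 2 * δ))
    hx0.le (by positivity) ?_ ?_
  · refine hmain.trans ?_
    have e1 : x ^ (1 / 2 + δ) * y ^ (1 / 2 + δ) ≤ x ^ (1 / 2 + ε) * y ^ ((1 : ℝ) / 2) := by
      calc x ^ (1 / 2 + δ) * y ^ (1 / 2 + δ) = x ^ (1 / 2 + δ) * (y ^ ((1 : ℝ) / 2) * y ^ δ) := by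
            rw [Real.rpow_add hy0]
        _ ≤ x ^ (1 / 2 + δ) * (y ^ ((1 : ℝ) / 2) * x ^ δ) := by gcongr
        _ = x ^ (1 / 2 + δ + δ) * y ^ ((1 : ℝ) / 2) := by rw [Real.rpow_add hx0 (1 / 2 + δ) δ]; ring
        _ ≤ _ := by
            gcongr ?_ * _
            exact Real.rpow_le_rpow_of_exponent_le hx1 (by linarith)
    have e2 : x * y ^ (-(1 / 2) + 2 * δ) ≤ x ^ (1 + ε) * y ^ (-(1 : ℝ) / 2) := by
      calc x * y ^ (-(1 / 2) + 2 * δ) = x * (y ^ (-(1 : ℝ) / 2) * y ^ (2 * δ)) := by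
            rw [Real.rpow_add hy0, neg_div]
        _ ≤ x * (y ^ (-(1 : ℝ) / 2) * x ^ (2 * δ)) := by gcongr
        _ = x ^ (1 + 2 * δ) * y ^ (-(1 : ℝ) / 2) := by
            rw [Real.rpow_add hx0, Real.rpow_one]; ring
        _ ≤ _ := by
            gcongr ?_ * _
            exact Real.rpow_le_rpow_of_exponent_le hx1 (by linarith)
    set A := x ^ (1 + ε) * y ^ (-(1 : ℝ) / 2)
    set B := x ^ (1 / 2 + ε) * y ^ ((1 : ℝ) / 2)
    have hA : 0 ≤ A := by positivity
    have hB : 0 ≤ B := by positivity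
    calc S * (K₁ * x ^ (1 / 2 + δ) * y ^ (1 / 2 + δ) + K₂ * x * y ^ (-(1 / 2) + 2 * δ))
        = S * (K₁ * (x ^ (1 / 2 + δ) * y ^ (1 / 2 + δ)) + K₂ * (x * y ^ (-(1 / 2) + 2 * δ))) := by
          ring
      _ ≤ S * (K₁ * (A + B) + K₂ * (A + B)) := by
          gcongr <;> linarith
      _ = _ := by ring
  · intro z hz hzy
    have hN : (0 : ℝ) < pairModulus z := by exact_mod_cast hz.pairModulus_pos
    refine (h₁ _ _ x hz.1 hz.le_pairModulus (hzy.trans hyx)).trans ?_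
    have h3 : 1 ≤ y ^ (1 / 2 + δ) * (pairModulus z : ℝ) ^ (-(1 / 2 + δ)) := by
      rw [Real.rpow_neg hN.le, ← div_eq_mul_inv, one_le_div (by positivity)]
      gcongr
    calc K₁ * x ^ (1 / 2 + δ) ≤ K₁ * x ^ (1 / 2 + δ) *
          (y ^ (1 / 2 + δ) * (pairModulus z : ℝ) ^ (-(1 / 2 + δ))) :=
          le_mul_of_one_le_right (by positivity) h3
      _ = (K₁ * x ^ (1 / 2 + δ) * y ^ (1 / 2 + δ)) * (pairModulus z : ℝ) ^ (-(1 / 2 + δ)) := by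
          ring
      _ ≤ _ := by
          gcongr
          exact le_add_of_nonneg_right (by positivity)
  · intro z hz hzy
    have hN : (0 : ℝ) < pairModulus z := by exact_mod_cast hz.pairModulus_pos
    have h3 : (pairModulus z : ℝ) ^ (-1 + δ) ≤
        y ^ (-(1 / 2) + 2 * δ) * (pairModulus z : ℝ) ^ (-(1 / 2 + δ)) := by
      rw [show -1 + δ = (-(1 / 2) + 2 * δ) + (-(1 / 2 + δ)) by ring, Real.rpow_add hN]
      gcongr ?_ * _
      exact Real.rpow_le_rpow_of_nonpos hy0 hzy.le (by linarith)
    calc x * |progDensity (pairModulus z) z.1|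
        ≤ x * (K₂ * (y ^ (-(1 / 2) + 2 * δ) * (pairModulus z : ℝ) ^ (-(1 / 2 + δ)))) := by
          gcongr
          exact (h₂ _ _ hz.1 hz.le_pairModulus).trans (by gcongr)
      _ = (K₂ * x * y ^ (-(1 / 2) + 2 * δ)) * (pairModulus z : ℝ) ^ (-(1 / 2 + δ)) := by ring
      _ ≤ _ := by
          gcongr
          exact le_add_of_nonneg_left (by positivity)

lemma exists_abs_mainSum_self_sub_le :
    ∃ K : ℝ, ∀ x : ℝ, 1 ≤ x → |mainSum x x - mainConst * x| ≤ K * x ^ (11 / 12 : ℝ) := by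
  obtain ⟨K₁, hK₁, h₁⟩ := exists_abs_progSum_sub_le (ε := 1 / 12) (by norm_num) (by norm_num)
  obtain ⟨K₂, hK₂, h₂⟩ := exists_abs_progDensity_le (ε := 1 / 12) (by norm_num)
  obtain ⟨K₃, hK₃, h₃⟩ := exists_progSum_le (ε := 1 / 12) (by norm_num)
  obtain ⟨S, hS, h⟩ := exists_abs_mainSum_sub_le (σ := 2 / 3) (by norm_num)
  refine ⟨S * (K₁ + K₂ + K₃), fun x hx => ?_⟩
  have hx0 : 0 < x := by linarith
  have hdens : ∀ z, IsSquarefullPair z → x ^ (1 / 2 : ℝ) ≤ pairModulus z →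
      x * |progDensity (pairModulus z) z.1| ≤
        K₂ * x ^ (11 / 12 : ℝ) * (pairModulus z : ℝ) ^ (-(2 / 3) : ℝ) := by
    intro z hz hzx
    have hN : (0 : ℝ) < pairModulus z := by exact_mod_cast hz.pairModulus_pos
    have e1 : (pairModulus z : ℝ) ^ (-1 + 1 / 12 : ℝ) =
        (pairModulus z : ℝ) ^ (-(1 / 4) : ℝ) * (pairModulus z : ℝ) ^ (-(2 / 3) : ℝ) := by
      rw [← Real.rpow_add hN]; norm_num
    have e2 : x * (pairModulus z : ℝ) ^ (-(1 / 4) : ℝ) ≤ x ^ (11 / 12 : ℝ) := by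
      calc x * (pairModulus z : ℝ) ^ (-(1 / 4) : ℝ)
          ≤ x * (x ^ (1 / 2 : ℝ)) ^ (-(1 / 4) : ℝ) := by
            gcongr ?_ * ?_
            exact Real.rpow_le_rpow_of_nonpos (by positivity) hzx (by norm_num)
        _ = x ^ (7 / 8 : ℝ) := by
            rw [← Real.rpow_mul hx0.le, mul_comm, ← Real.rpow_add_one hx0.ne']; norm_num
        _ ≤ _ := Real.rpow_le_rpow_of_exponent_le hx (by norm_num)
    calc x * |progDensity (pairModulus z) z.1|
        ≤ x * (K₂ * (pairModulus z : ℝ) ^ (-1 + 1 / 12 : ℝ)) := by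
          gcongr
          exact h₂ _ _ hz.1 hz.le_pairModulus
      _ = K₂ * (x * (pairModulus z : ℝ) ^ (-(1 / 4) : ℝ)) *
          (pairModulus z : ℝ) ^ (-(2 / 3) : ℝ) := by rw [e1]; ring
      _ ≤ _ := by gcongr
  have hmain := h x x ((K₁ + K₂ + K₃) * x ^ (11 / 12 : ℝ)) hx0.le (by positivity) ?_ ?_
  · rwa [← mul_assoc] at hmain
  · intro z hz hzx
    have hN : (0 : ℝ) < pairModulus z := by exact_mod_cast hz.pairModulus_pos
    rcases le_total (pairModulus z : ℝ) (x ^ (1 / 2 : ℝ)) with hsmall | hlarge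
    · have e1 : x ^ (1 / 2 + 1 / 12 : ℝ) ≤
          x ^ (11 / 12 : ℝ) * (pairModulus z : ℝ) ^ (-(2 / 3) : ℝ) := by
        calc x ^ (1 / 2 + 1 / 12 : ℝ)
            = x ^ (11 / 12 : ℝ) * (x ^ (1 / 2 : ℝ)) ^ (-(2 / 3) : ℝ) := by
              rw [← Real.rpow_mul hx0.le, ← Real.rpow_add hx0]; norm_num
          _ ≤ _ := by
              gcongr ?_ * ?_
              exact Real.rpow_le_rpow_of_nonpos hN hsmall (by norm_num)
      calc _ ≤ K₁ * x ^ (1 / 2 + 1 / 12 : ℝ) := h₁ _ _ x hz.1 hz.le_pairModulus hzx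
        _ ≤ (K₁ + K₂ + K₃) * (x ^ (11 / 12 : ℝ) * (pairModulus z : ℝ) ^ (-(2 / 3) : ℝ)) := by
            gcongr
            linarith
        _ = _ := by ring
    · have e1 : x ^ (1 + 1 / 12 : ℝ) / pairModulus z ≤
          x ^ (11 / 12 : ℝ) * (pairModulus z : ℝ) ^ (-(2 / 3) : ℝ) := by
        have e2 : ((pairModulus z : ℝ))⁻¹ =
            (pairModulus z : ℝ) ^ (-(1 / 3) : ℝ) * (pairModulus z : ℝ) ^ (-(2 / 3) : ℝ) := by
          rw [← Real.rpow_add hN, ← Real.rpow_neg_one]; norm_num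
        rw [div_eq_mul_inv, e2, ← mul_assoc]
        gcongr ?_ * _
        calc _ ≤ x ^ (1 + 1 / 12 : ℝ) * (x ^ (1 / 2 : ℝ)) ^ (-(1 / 3) : ℝ) := by
              gcongr ?_ * ?_
              exact Real.rpow_le_rpow_of_nonpos (by positivity) hlarge (by norm_num)
          _ = _ := by rw [← Real.rpow_mul hx0.le, ← Real.rpow_add hx0]; norm_num
      calc _ ≤ |progSum (pairModulus z) z.1 x| + |x * progDensity (pairModulus z) z.1| :=
            abs_sub _ _
        _ ≤ K₃ * (x ^ (1 + 1 / 12 : ℝ) / pairModulus z) +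
            K₂ * x ^ (11 / 12 : ℝ) * (pairModulus z : ℝ) ^ (-(2 / 3) : ℝ) := by
            rw [abs_of_nonneg (progSum_nonneg _ _ _), abs_mul, abs_of_pos hx0, ← mul_div_assoc]
            exact add_le_add (h₃ _ _ x hz.1 hz.le_pairModulus hzx) (hdens z hz hlarge)
        _ ≤ K₃ * (x ^ (11 / 12 : ℝ) * (pairModulus z : ℝ) ^ (-(2 / 3) : ℝ)) +
            K₂ * x ^ (11 / 12 : ℝ) * (pairModulus z : ℝ) ^ (-(2 / 3) : ℝ) := by gcongr
        _ = (K₂ + K₃) * x ^ (11 / 12 : ℝ) * (pairModulus z : ℝ) ^ (-(2 / 3) : ℝ) := by ring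
        _ ≤ _ := by
            gcongr
            linarith
  · intro z hz hzx
    refine (hdens z hz (le_trans ?_ hzx.le)).trans ?_
    · conv_rhs => rw [← Real.rpow_one x]
      exact Real.rpow_le_rpow_of_exponent_le hx (by norm_num)
    · gcongr
      linarith

lemma sq_dvd_sq_mul_iff {a b d : ℕ} (ha : Squarefree a) (hb : b ≠ 0) :
    d ^ 2 ∣ b ^ 2 * a ↔ d ∣ b := by
  refine ⟨fun h => ?_, fun h => (pow_dvd_pow_of_dvd h 2).mul_right a⟩
  have hg : 0 < d.gcd b := Nat.gcd_pos_of_pos_right _ (Nat.pos_of_ne_zero hb)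
  obtain ⟨d', b', hcop, hd, hb'⟩ := Nat.exists_coprime d b
  set g := d.gcd b
  have h1 : g ^ 2 * d' ^ 2 ∣ g ^ 2 * (b' ^ 2 * a) := by
    have e1 : g ^ 2 * d' ^ 2 = d ^ 2 := by rw [hd]; ring
    have e2 : g ^ 2 * (b' ^ 2 * a) = b ^ 2 * a := by rw [hb']; ring
    rwa [e1, e2]
  have h2 : d' ^ 2 ∣ b' ^ 2 * a := Nat.dvd_of_mul_dvd_mul_left (by positivity) h1
  have h3 : d' ^ 2 ∣ a := Nat.Coprime.dvd_of_dvd_mul_left (Nat.Coprime.pow 2 2 hcop) h2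
  rw [sq] at h3
  have h4 : d' = 1 := Nat.isUnit_iff.mp (ha d' h3)
  rw [h4, one_mul] at hd
  rw [hd]
  exact Nat.gcd_dvd_right d b

lemma sum_moebius_sq_dvd {m X : ℕ} (hm : m ≠ 0) (hmX : m ≤ X) :
    ∑ d ∈ (Finset.Icc 1 X).filter (fun d => d ^ 2 ∣ m), (ArithmeticFunction.moebius d : ℝ) =
      if Squarefree m then 1 else 0 := by
  obtain ⟨a, b, rfl, ha⟩ := Nat.sq_mul_squarefree m
  have hb : b ≠ 0 := by rintro rfl; simp at hm
  have hfilter : (Finset.Icc 1 X).filter (fun d => d ^ 2 ∣ b ^ 2 * a) = b.divisors := by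
    ext d
    simp only [Finset.mem_filter, Finset.mem_Icc, Nat.mem_divisors, sq_dvd_sq_mul_iff ha hb]
    constructor
    · rintro ⟨-, h⟩; exact ⟨h, hb⟩
    · rintro ⟨h, -⟩
      have h0 := Nat.le_of_dvd (Nat.pos_of_ne_zero hb) h
      have h1 : b ≤ b ^ 2 := Nat.le_self_pow two_ne_zero b
      have h2 : b ^ 2 ≤ b ^ 2 * a := Nat.le_mul_of_pos_right _ (Nat.pos_of_ne_zero ha.ne_zero)
      exact ⟨⟨Nat.pos_of_dvd_of_pos h (Nat.pos_of_ne_zero hb), by omega⟩, h⟩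
  rw [hfilter, ← Int.cast_sum, ← ArithmeticFunction.coe_mul_zeta_apply,
    ArithmeticFunction.moebius_mul_coe_zeta, ArithmeticFunction.one_apply]
  have hiff : b = 1 ↔ Squarefree (b ^ 2 * a) := by
    constructor
    · rintro rfl; simpa using ha
    · intro h
      exact Nat.isUnit_iff.mp (h b ⟨a, by ring⟩)
  rw [if_congr hiff rfl rfl]
  split_ifs <;> simp

/-- Detecting squarefree integers by `∑ μ(d)` over `d ^ 2 ∣ m`. -/
lemma sum_moebius_mul_sum_eq {s X : ℕ} (hs : s ≠ 0) (f : ℕ → ℝ) :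
    ∑ d ∈ (Finset.Icc 1 X).filter (fun d => d ^ 2 * s ≤ X ∧ d.gcd s = 1),
      (ArithmeticFunction.moebius d : ℝ) *
        ∑ n ∈ (Finset.Icc 1 (X / (d ^ 2 * s))).filter (fun n => n.gcd s = 1), f (d ^ 2 * n) =
      ∑ m ∈ (Finset.Icc 1 (X / s)).filter (fun m => m.gcd s = 1),
        if Squarefree m then f m else 0 := by
  have hs0 : 0 < s := Nat.pos_of_ne_zero hs
  have h1 : ∀ m ∈ (Finset.Icc 1 (X / s)).filter (fun m => m.gcd s = 1),
      (if Squarefree m then f m else 0) = ∑ d ∈ Finset.Icc 1 X,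
        if d ^ 2 ∣ m then (ArithmeticFunction.moebius d : ℝ) * f m else 0 := by
    intro m hm
    simp only [Finset.mem_filter, Finset.mem_Icc] at hm
    rw [← Finset.sum_filter, ← Finset.sum_mul,
      sum_moebius_sq_dvd (by omega) (hm.1.2.trans (Nat.div_le_self X s))]
    split_ifs <;> simp
  rw [Finset.sum_congr rfl h1, Finset.sum_comm, Finset.sum_filter]
  refine Finset.sum_congr rfl fun d hd => ?_
  have hd0 : 0 < d := (Finset.mem_Icc.mp hd).1
  have hd2 : 0 < d ^ 2 := by positivity
  rw [← Finset.sum_filter, ← Finset.mul_sum, Finset.filter_filter]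
  split_ifs with h
  · congr 1
    have hcop : (d ^ 2).Coprime s := Nat.Coprime.pow_left 2 h.2
    refine Finset.sum_bij (fun n _ => d ^ 2 * n) ?_ ?_ ?_ ?_
    · intro n hn
      simp only [Finset.mem_Icc, Finset.mem_filter] at hn ⊢
      refine ⟨⟨Nat.mul_pos hd2 hn.1.1, ?_⟩, ?_, dvd_mul_right _ _⟩
      · rw [Nat.le_div_iff_mul_le hs0]
        have := (Nat.le_div_iff_mul_le (by positivity)).mp hn.1.2
        calc d ^ 2 * n * s = n * (d ^ 2 * s) := by ring
          _ ≤ X := this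
      · exact Nat.Coprime.mul_left hcop hn.2
    · intro a _ b _ hab
      exact Nat.eq_of_mul_eq_mul_left hd2 hab
    · intro m hm
      simp only [Finset.mem_Icc, Finset.mem_filter] at hm
      obtain ⟨⟨h2, h3⟩, h4, n, rfl⟩ := hm
      refine ⟨n, ?_, rfl⟩
      simp only [Finset.mem_Icc, Finset.mem_filter]
      refine ⟨⟨Nat.pos_of_mul_pos_left h2, ?_⟩, Nat.Coprime.coprime_mul_left h4⟩
      rw [Nat.le_div_iff_mul_le (by positivity)]
      have := (Nat.le_div_iff_mul_le hs0).mp h3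
      calc n * (d ^ 2 * s) = d ^ 2 * n * s := by ring
        _ ≤ X := this
    · intro _ _
      rfl
  · symm
    rw [mul_eq_zero]
    right
    rw [Finset.sum_eq_zero]
    intro m hm
    exfalso
    simp only [Finset.mem_Icc, Finset.mem_filter] at hm
    obtain ⟨⟨h2, h3⟩, h4, h5⟩ := hm
    refine h ⟨?_, ?_⟩
    · have h6 := (Nat.le_div_iff_mul_le hs0).mp h3
      exact (Nat.mul_le_mul_right s (Nat.le_of_dvd h2 h5)).trans h6
    · exact Nat.Coprime.coprime_dvd_left ((dvd_pow_self d two_ne_zero).trans h5) h4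

lemma exists_squarefull_mul_squarefree (n : ℕ) (hn : n ≠ 0) :
    ∃ s m : ℕ, n = s * m ∧ Squarefull s ∧ Squarefree m ∧ m.Coprime s := by
  have hone : Squarefull 1 := fun p hp h => absurd (Nat.dvd_one.mp h) hp.one_lt.ne'
  induction n using Nat.recOnPosPrimePosCoprime with
  | zero => exact absurd rfl hn
  | one => exact ⟨1, 1, rfl, hone, squarefree_one, Nat.coprime_one_left 1⟩
  | prime_pow p k hp hk =>
    rcases Nat.lt_or_ge 1 k with h | h
    · refine ⟨p ^ k, 1, (mul_one _).symm, fun q hq hqp => ?_, squarefree_one,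
        Nat.coprime_one_left _⟩
      rw [(Nat.prime_dvd_prime_iff_eq hq hp).mp (hq.dvd_of_dvd_pow hqp)]
      exact pow_dvd_pow p h
    · obtain rfl : k = 1 := by omega
      exact ⟨1, p, by simp, hone, hp.prime.squarefree, Nat.coprime_one_right p⟩
  | coprime a b ha hb hab iha ihb =>
    obtain ⟨s, m, rfl, hs, hm, hsm⟩ := iha (by omega)
    obtain ⟨t, l, rfl, ht, hl, htl⟩ := ihb (by omega)
    rw [Nat.coprime_mul_iff_left, Nat.coprime_mul_iff_right, Nat.coprime_mul_iff_right] at hab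
    obtain ⟨⟨hst, hsl⟩, hmt, hml⟩ := hab
    refine ⟨s * t, m * l, by ring, fun p hp h => ?_, (Nat.squarefree_mul hml).mpr ⟨hm, hl⟩, ?_⟩
    · rcases (hp.dvd_mul).mp h with h | h
      · exact (hs p hp h).mul_right t
      · exact (ht p hp h).mul_left s
    · exact Nat.Coprime.mul_left (Nat.Coprime.mul_right hsm hmt)
        (Nat.Coprime.mul_right hsl.symm htl)

lemma le_mainSum_self (X : ℕ) : (X : ℝ) ≤ mainSum X X := by
  classical
  rw [mainSum_eq, Nat.floor_natCast]
  have h1 : ∀ s ∈ (Finset.Icc 1 X).filter Squarefull,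
      (((Finset.Icc 1 (X / s)).filter (fun m => m.gcd s = 1 ∧ Squarefree m)).card : ℝ) ≤
      ∑ d ∈ (Finset.Icc 1 X).filter
          (fun d => ((d ^ 2 * s : ℕ) : ℝ) ≤ (X : ℝ) ∧ Nat.gcd d s = 1),
        (ArithmeticFunction.moebius d : ℝ) *
          ∑ n ∈ (Finset.Icc 1 ⌊(X : ℝ) / ((d : ℝ) ^ 2 * (s : ℝ))⌋₊).filter
              (fun n => Nat.gcd n s = 1),
            (abelianCount (d ^ 2 * n * s + abelianCount s) : ℝ) := by
    intro s hs
    have hs0 : s ≠ 0 := by simp at hs; omega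
    have h2 := sum_moebius_mul_sum_eq (X := X) hs0
      (fun m => (abelianCount (m * s + abelianCount s) : ℝ))
    have h3 : ∀ d : ℕ, ⌊(X : ℝ) / ((d : ℝ) ^ 2 * (s : ℝ))⌋₊ = X / (d ^ 2 * s) := by
      intro d
      rw [← Nat.floor_div_eq_div (K := ℝ)]
      push_cast
      rfl
    simp only [h3, Nat.cast_le]
    rw [h2, ← Finset.sum_filter, Finset.filter_filter, Finset.cast_card]
    exact Finset.sum_le_sum fun m _ => by exact_mod_cast abelianCount_pos _
  refine le_trans ?_ (Finset.sum_le_sum h1)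
  rw [← Nat.cast_sum, ← Finset.card_sigma, Nat.cast_le]
  have hsub : Finset.Icc 1 X ⊆ (((Finset.Icc 1 X).filter Squarefull).sigma fun s =>
      (Finset.Icc 1 (X / s)).filter (fun m => m.gcd s = 1 ∧ Squarefree m)).image
        (fun z => z.1 * z.2) := by
    intro n hn
    rw [Finset.mem_Icc] at hn
    obtain ⟨s, m, rfl, hs, hm, hsm⟩ := exists_squarefull_mul_squarefree n (by omega)
    have hs0 : 0 < s := Nat.pos_of_mul_pos_right hn.1
    have hm0 : 0 < m := Nat.pos_of_mul_pos_left hn.1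
    rw [Finset.mem_image]
    refine ⟨⟨s, m⟩, ?_, rfl⟩
    simp only [Finset.mem_sigma, Finset.mem_filter, Finset.mem_Icc]
    refine ⟨⟨⟨hs0, (Nat.le_mul_of_pos_right s hm0).trans hn.2⟩, hs⟩, ⟨hm0, ?_⟩, hsm, hm⟩
    rw [Nat.le_div_iff_mul_le hs0, mul_comm]
    exact hn.2
  calc X = (Finset.Icc 1 X).card := by simp
    _ ≤ _ := Finset.card_le_card hsub
    _ ≤ _ := Finset.card_image_le

lemma one_le_mainConst : 1 ≤ mainConst := by
  obtain ⟨K, hK⟩ := exists_abs_mainSum_self_sub_le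
  have hlim : Filter.Tendsto (fun X : ℕ => K * (X : ℝ) ^ (-(1 / 12) : ℝ)) Filter.atTop
      (nhds (K * 0)) :=
    ((tendsto_rpow_neg_atTop (by norm_num)).comp tendsto_natCast_atTop_atTop).const_mul K
  rw [mul_zero] at hlim
  have hle : 1 - mainConst ≤ 0 := by
    refine ge_of_tendsto hlim ?_
    filter_upwards [Filter.eventually_ge_atTop 1] with X hX
    have hX1 : (1 : ℝ) ≤ X := by exact_mod_cast hX
    have hX0 : (0 : ℝ) < X := by linarith
    have h1 := (le_abs_self _).trans (hK X hX1)
    have h2 := le_mainSum_self X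
    have h3 : (X : ℝ) ^ (11 / 12 : ℝ) = (X : ℝ) ^ (-(1 / 12) : ℝ) * X := by
      rw [← Real.rpow_add_one hX0.ne']; norm_num
    rw [h3] at h1
    refine le_of_mul_le_mul_right ?_ hX0
    linarith
  linarith

open scoped Classical in
theorem main_term_asymptotic :
    ∃ C : ℝ, 0 < C ∧
      ∀ ε : ℝ, 0 < ε → ∃ Cε : ℝ, 0 < Cε ∧
        ∀ x y : ℝ, 3 ≤ x → x ^ ε ≤ y → y ≤ x ^ ((1 : ℝ) / 2) →
          |(∑ s ∈ (Finset.Icc 1 ⌊y⌋₊).filter Squarefull,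
              ∑ d ∈ (Finset.Icc 1 ⌊y⌋₊).filter
                  (fun d => ((d ^ 2 * s : ℕ) : ℝ) ≤ y ∧ Nat.gcd d s = 1),
                (ArithmeticFunction.moebius d : ℝ) *
                  ∑ n ∈ (Finset.Icc 1 ⌊x / ((d : ℝ) ^ 2 * (s : ℝ))⌋₊).filter
                      (fun n => Nat.gcd n s = 1),
                    (abelianCount (d ^ 2 * n * s + abelianCount s) : ℝ)) - C * x| ≤
            Cε * (x ^ (1 + ε) * y ^ (-(1 : ℝ) / 2) + x ^ (1 / 2 + ε) * y ^ ((1 : ℝ) / 2)) := by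
  refine ⟨mainConst, zero_lt_one.trans_le one_le_mainConst, fun ε hε => ?_⟩
  obtain ⟨K, hK, h⟩ := exists_abs_mainSum_sub_mainConst_le hε
  refine ⟨K, hK, fun x y hx hxy hyx => ?_⟩
  have hx1 : 1 ≤ x := by linarith
  have hyx' : y ≤ x := hyx.trans (Real.rpow_le_self_of_one_le hx1 (by norm_num))
  rw [← mainSum_eq]
  exact h x y ((Real.one_le_rpow hx1 hε.le).trans hxy) hyx'
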